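/- For all n ≥ 1, the characteristic polynomial of the bond lattice Π_{Γ_{2n}} satisfies χ_{2n}(t) = Σ_{σ ∈ D_{2n}} (−1)^{c(σ)} t^{c(σ)−1} as polynomials in t, where the sum is over all D-permutations σ on [2n] and c(σ) is the number of cycles of σ. Equivalently, χ_{2n}(t) = Σ_{k=1}^{2n} s_D(2n,k) t^{k−1}, where (−1)^k s_D(2n,k) is the number of D-permutations on [2n] with exactly k cycles. -/

import Mathlib

open Finset

/-- The Ferrers graph on vertex set `V ⊆ ℕ`: edges `{u,v}` with `u < v`, `u` odd, `v` even. -/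
def ferrers (V : Finset ℕ) : SimpleGraph ℕ :=
  SimpleGraph.fromRel (fun u v => u ∈ V ∧ v ∈ V ∧ u < v ∧ Odd u ∧ Even v)

/-- A partition of `V` is a bond partition if each block induces a connected subgraph. -/
def IsBond (V : Finset ℕ) (P : Finpartition V) : Prop :=
  ∀ B ∈ P.parts, ((ferrers V).induce (B : Set ℕ)).Connected

/-- `u` is a (strict) descendant of `v` in the graph `G` rooted (componentwise) at `r`. -/
def DescOf {α : Type*} (G : SimpleGraph α) (r v u : α) : Prop :=
  u ≠ v ∧ G.Reachable u r ∧ ∀ p : G.Walk u r, v ∈ p.support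

/-- `F` is an increasing-decreasing (ID) forest. -/
def IsIDForest (V : Finset ℕ) (F : SimpleGraph {x // x ∈ V}) : Prop :=
  F.IsAcyclic ∧
  ∀ r v : {x // x ∈ V}, F.Reachable v r → (∀ u, F.Reachable v u → (u : ℕ) ≤ (r : ℕ)) →
    (Odd (v : ℕ) →
      (∀ u, DescOf F r v u → (v : ℕ) < (u : ℕ)) ∧
      (∀ u, F.Adj v u → DescOf F r v u → Even (u : ℕ))) ∧
    (Even (v : ℕ) →
      (∀ u, DescOf F r v u → (u : ℕ) < (v : ℕ)) ∧
      (∀ u, F.Adj v u → DescOf F r v u → Odd (u : ℕ)))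

/-- `T` is an increasing-decreasing (ID) tree. -/
def IsIDTree (V : Finset ℕ) (T : SimpleGraph {x // x ∈ V}) : Prop :=
  T.Connected ∧ IsIDForest V T

/-- A D-permutation on `A`. -/
def IsDPerm (A : Finset ℕ) (σ : Equiv.Perm {x // x ∈ A}) : Prop :=
  ∀ i : {x // x ∈ A}, (Odd (i : ℕ) → (i : ℕ) ≤ (σ i : ℕ)) ∧ (Even (i : ℕ) → (σ i : ℕ) ≤ (i : ℕ))

/-- A D-cycle on `A`: a D-permutation which is a single cycle covering `A`. -/
def IsDCycle (A : Finset ℕ) (σ : Equiv.Perm {x // x ∈ A}) : Prop :=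
  IsDPerm A σ ∧ ∀ x y : {x // x ∈ A}, σ.SameCycle x y

/-- The number of cycles (orbits, fixed points included) of a permutation. -/
noncomputable def cycleCount {α : Type*} (σ : Equiv.Perm α) : ℕ :=
  Nat.card (Quotient (⟨σ.SameCycle, Equiv.Perm.SameCycle.equivalence σ⟩ : Setoid α))

/-- A Dumont permutation on `A` (intended for `A = [2m]`). -/
def IsDumontPerm (A : Finset ℕ) (σ : Equiv.Perm {x // x ∈ A}) : Prop :=
  ∀ i : {x // x ∈ A}, (Even (i : ℕ) → (σ i : ℕ) < (i : ℕ)) ∧ (Odd (i : ℕ) → (i : ℕ) ≤ (σ i : ℕ))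

/-- A Dumont derangement on `A` (intended for `A = [2m]`). -/
def IsDumontDerangement (A : Finset ℕ) (σ : Equiv.Perm {x // x ∈ A}) : Prop :=
  ∀ i : {x // x ∈ A}, (Even (i : ℕ) → (σ i : ℕ) < (i : ℕ)) ∧ (Odd (i : ℕ) → (i : ℕ) < (σ i : ℕ))

/-- The Genocchi number `g n`: the number of Dumont permutations on `[2n-2]`. -/
noncomputable def genocchi (n : ℕ) : ℕ :=
  Nat.card {σ : Equiv.Perm {x // x ∈ Finset.Icc 1 (2 * n - 2)} // IsDumontPerm _ σ}

/-- The median Genocchi number `h n`: the number of Dumont derangements on `[2n+2]`. -/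
noncomputable def medianGenocchi (n : ℕ) : ℕ :=
  Nat.card {σ : Equiv.Perm {x // x ∈ Finset.Icc 1 (2 * n + 2)} // IsDumontDerangement _ σ}

open scoped Classical

/-- Functions that are constant on the classes of `r` correspond to functions on the quotient. -/
theorem card_filter_constant_on_classes {α : Type*} [Fintype α] (r : Setoid α) (q : ℕ) :
    #{f : α → Fin q | ∀ x y, r x y → f x = f y} = q ^ Nat.card (Quotient r) := by
  have h : Nat.card {f : α → Fin q // r ≤ Setoid.ker f} = q ^ Nat.card (Quotient r) := by
    rw [Nat.card_congr (Setoid.liftEquiv r), Nat.card_fun]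
    simp
  rw [← h, Nat.card_eq_fintype_card, Fintype.card_subtype]
  congr 1
  ext f
  simp only [Finset.mem_filter, Finset.mem_univ, true_and]
  rfl

/-- The setoid on the elements of `V` whose classes are the blocks of `P`. -/
def Finpartition.blockSetoid {V : Finset ℕ} (P : Finpartition V) : Setoid {x // x ∈ V} :=
  Setoid.ker fun x => (⟨P.part x, P.part_mem.2 x.2⟩ : {B // B ∈ P.parts})

theorem Finpartition.blockSetoid_iff {V : Finset ℕ} (P : Finpartition V) (x y : {x // x ∈ V}) :
    P.blockSetoid x y ↔ P.part x = P.part y := by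
  rw [blockSetoid, Setoid.ker_def, Subtype.mk.injEq]

theorem Finpartition.card_quotient_blockSetoid {V : Finset ℕ} (P : Finpartition V) :
    Nat.card (Quotient P.blockSetoid) = #P.parts := by
  have hs : Function.Surjective
      fun x : {x // x ∈ V} => (⟨P.part x, P.part_mem.2 x.2⟩ : {B // B ∈ P.parts}) := by
    rintro ⟨B, hB⟩
    obtain ⟨x, hx⟩ := P.nonempty_of_mem_parts hB
    exact ⟨⟨x, P.le hB hx⟩, Subtype.ext (P.part_eq_of_mem hB hx)⟩
  rw [Finpartition.blockSetoid, Nat.card_congr (Setoid.quotientKerEquivOfSurjective _ hs)]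
  simp

theorem ferrers_adj_iff {V : Finset ℕ} {u v : ℕ} :
    (ferrers V).Adj u v ↔ u ∈ V ∧ v ∈ V ∧ (u < v ∧ Odd u ∧ Even v ∨ v < u ∧ Odd v ∧ Even u) := by
  simp only [ferrers, SimpleGraph.fromRel_adj]
  constructor
  · rintro ⟨-, h | h⟩ <;> tauto
  · rintro ⟨hu, hv, h | h⟩
    · exact ⟨h.1.ne, by tauto⟩
    · exact ⟨h.1.ne', by tauto⟩

/-- A colouring of `V` is proper if adjacent vertices of the Ferrers graph differ in colour. -/
def IsProperColoring (V : Finset ℕ) {ι : Type*} (f : {x // x ∈ V} → ι) : Prop :=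
  ∀ u v : {x // x ∈ V}, (ferrers V).Adj u v → f u ≠ f v

/-- The subgraph of monochromatic edges of a colouring of the Ferrers graph. -/
def monochromatic (V : Finset ℕ) {ι : Type*} (f : {x // x ∈ V} → ι) : SimpleGraph ℕ where
  Adj u v := (ferrers V).Adj u v ∧ ∃ hu hv, f ⟨u, hu⟩ = f ⟨v, hv⟩
  symm := ⟨fun _ _ ⟨h, hu, hv, e⟩ => ⟨h.symm, hv, hu, e.symm⟩⟩
  loopless := ⟨fun _ h => h.1.ne rfl⟩

section Bond

variable {V : Finset ℕ} {ι : Type*} (f : {x // x ∈ V} → ι)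

theorem eq_of_reachable_monochromatic {a b : ℕ} (h : (monochromatic V f).Reachable a b)
    (ha : a ∈ V) : ∃ hb, f ⟨a, ha⟩ = f ⟨b, hb⟩ := by
  rw [SimpleGraph.reachable_iff_reflTransGen] at h
  induction h with
  | refl => exact ⟨ha, rfl⟩
  | tail _ hbc ih =>
    obtain ⟨hb, e⟩ := ih
    obtain ⟨-, _, hc, e'⟩ := hbc
    exact ⟨hc, e.trans e'⟩

/-- The partition of `V` into monochromatic components of a colouring. -/
noncomputable def monochromaticPartition : Finpartition V :=
  Finpartition.ofSetSetoid (monochromatic V f).reachableSetoid V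

theorem mem_parts_monochromaticPartition {B : Finset ℕ} :
    B ∈ (monochromaticPartition f).parts ↔
      ∃ a ∈ V, {b ∈ V | (monochromatic V f).Reachable a b} = B := by
  simp only [monochromaticPartition, Finpartition.ofSetSetoid_parts, Finset.mem_image]
  rfl

theorem isBond_monochromaticPartition : IsBond V (monochromaticPartition f) := by
  intro B hB
  obtain ⟨a, ha, rfl⟩ := (mem_parts_monochromaticPartition f).1 hB
  set B : Finset ℕ := {b ∈ V | (monochromatic V f).Reachable a b} with hBdef
  have haB : a ∈ (B : Set ℕ) := by simp [hBdef, ha]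
  have key : ∀ b, (monochromatic V f).Reachable a b → ∃ hb : b ∈ (B : Set ℕ),
      ((ferrers V).induce (B : Set ℕ)).Reachable ⟨a, haB⟩ ⟨b, hb⟩ := by
    intro b h
    rw [SimpleGraph.reachable_iff_reflTransGen] at h
    induction h with
    | refl => exact ⟨haB, .rfl⟩
    | @tail b c hab hbc ih =>
      obtain ⟨hb, hr⟩ := ih
      have hc : c ∈ (B : Set ℕ) := by
        have h1 := (SimpleGraph.reachable_iff_reflTransGen _ _).2 (hab.tail hbc)
        simp only [hBdef, Finset.coe_filter, Set.mem_ofPred_eq]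
        exact ⟨hbc.2.2.1, h1⟩
      refine ⟨hc, hr.trans (SimpleGraph.Adj.reachable ?_)⟩
      simpa using hbc.1
  rw [SimpleGraph.connected_iff_exists_forall_reachable]
  refine ⟨⟨a, haB⟩, fun ⟨b, hb⟩ => (key b ?_).2⟩
  simp only [hBdef, Finset.coe_filter, Set.mem_ofPred_eq] at hb
  exact hb.2

theorem le_monochromaticPartition_iff {P : Finpartition V} (hP : IsBond V P) :
    P ≤ monochromaticPartition f ↔ ∀ x y, P.blockSetoid x y → f x = f y := by
  constructor
  · intro h x y hxy
    rw [P.blockSetoid_iff] at hxy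
    obtain ⟨C, hC, hle⟩ := h (P.part_mem.2 x.2)
    obtain ⟨a, ha, rfl⟩ := (mem_parts_monochromaticPartition f).1 hC
    have hx := hle (P.mem_part x.2)
    have hy := hle (hxy ▸ P.mem_part y.2)
    simp only [Finset.mem_filter] at hx hy
    obtain ⟨_, e⟩ := eq_of_reachable_monochromatic f hx.2 ha
    obtain ⟨_, e'⟩ := eq_of_reachable_monochromatic f hy.2 ha
    exact e.symm.trans e'
  · intro h B hB
    obtain ⟨a, ha⟩ := P.nonempty_of_mem_parts hB
    refine ⟨_, (mem_parts_monochromaticPartition f).2 ⟨a, P.le hB ha, rfl⟩, fun b hb => ?_⟩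
    refine Finset.mem_filter.2 ⟨P.le hB hb, ?_⟩
    have hr := (hP B hB).preconnected ⟨a, ha⟩ ⟨b, hb⟩
    refine hr.elim fun p => ?_
    have hom : ∀ x y : (B : Set ℕ), ((ferrers V).induce (B : Set ℕ)).Adj x y →
        (monochromatic V f).Adj x y := by
      intro x y hxy
      refine ⟨by simpa using hxy, P.le hB x.2, P.le hB y.2, h _ _ ?_⟩
      rw [P.blockSetoid_iff, P.part_eq_of_mem hB x.2, P.part_eq_of_mem hB y.2]
    exact (p.map ⟨Subtype.val, fun {x y} => hom x y⟩).reachable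

theorem isBond_bot : IsBond V ⊥ := by
  intro B hB
  obtain ⟨a, -, rfl⟩ := Finpartition.mem_bot_iff.1 hB
  rw [SimpleGraph.connected_iff_exists_forall_reachable]
  refine ⟨⟨a, by simp⟩, fun ⟨b, hb⟩ => ?_⟩
  obtain rfl : b = a := by simpa using hb
  exact .rfl

theorem monochromaticPartition_eq_bot_iff :
    ⊥ = monochromaticPartition f ↔ IsProperColoring V f := by
  constructor
  · intro h u v huv e
    have hp : {b ∈ V | (monochromatic V f).Reachable u b} ∈ (⊥ : Finpartition V).parts :=
      h ▸ (mem_parts_monochromaticPartition f).2 ⟨u, u.2, rfl⟩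
    obtain ⟨a, -, ha⟩ := Finpartition.mem_bot_iff.1 hp
    have hadj : (monochromatic V f).Adj u v := ⟨huv, u.2, v.2, e⟩
    have hu : (u : ℕ) ∈ ({a} : Finset ℕ) := ha ▸ Finset.mem_filter.2 ⟨u.2, .rfl⟩
    have hv : (v : ℕ) ∈ ({a} : Finset ℕ) := ha ▸ Finset.mem_filter.2 ⟨v.2, hadj.reachable⟩
    rw [Finset.mem_singleton] at hu hv
    exact huv.ne (hu.trans hv.symm)
  · intro h
    refine le_antisymm bot_le fun B hB => ?_
    obtain ⟨a, ha, rfl⟩ := (mem_parts_monochromaticPartition f).1 hB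
    refine ⟨{a}, Finpartition.mem_bot_iff.2 ⟨a, ha, rfl⟩, fun b hb => ?_⟩
    have hr := (Finset.mem_filter.1 hb).2
    rw [SimpleGraph.reachable_iff_reflTransGen] at hr
    rw [Finset.mem_singleton]
    rcases Relation.ReflTransGen.cases_head hr with rfl | ⟨c, hc, -⟩
    · rfl
    · obtain ⟨hadj, hu, hv, e⟩ := hc
      exact absurd e (h ⟨a, hu⟩ ⟨c, hv⟩ hadj)

/-- The characteristic polynomial of the bond lattice counts proper colourings. -/
theorem sum_moebius_mul_pow_eq_card_isProperColoring (V : Finset ℕ) (q : ℕ)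
    (μ : Finpartition V → ℤ)
    (hμ : ∀ b, IsBond V b →
      (∑ c ∈ Finset.univ.filter fun c => IsBond V c ∧ c ≤ b, μ c) = if ⊥ = b then 1 else 0) :
    ∑ P ∈ Finset.univ.filter fun P : Finpartition V => IsBond V P, μ P * (q : ℤ) ^ #P.parts =
      #{f : {x // x ∈ V} → Fin q | IsProperColoring V f} := by
  calc
    _ = ∑ P ∈ Finset.univ.filter fun P : Finpartition V => IsBond V P,
          ∑ f : {x // x ∈ V} → Fin q, if P ≤ monochromaticPartition f then μ P else 0 := by
      refine Finset.sum_congr rfl fun P hP => ?_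
      rw [← P.card_quotient_blockSetoid, ← Nat.cast_pow, ← card_filter_constant_on_classes,
        ← Finset.sum_filter, Finset.sum_const, nsmul_eq_mul, mul_comm]
      congr! 3
      ext f
      simp only [Finset.mem_filter, Finset.mem_univ, true_and]
      exact (le_monochromaticPartition_iff f (Finset.mem_filter.1 hP).2).symm
    _ = ∑ f : {x // x ∈ V} → Fin q, if IsProperColoring V f then 1 else 0 := by
      rw [Finset.sum_comm]
      refine Finset.sum_congr rfl fun f _ => ?_
      have h := hμ _ (isBond_monochromaticPartition f)
      simp only [monochromaticPartition_eq_bot_iff] at h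
      rw [← h, ← Finset.sum_filter, Finset.filter_filter]
    _ = _ := by simp

end Bond

section Permutation

theorem cycleCount_eq_add {α : Type*} [Fintype α] (σ : Equiv.Perm α) :
    cycleCount σ = (Fintype.card α - #σ.support) + #σ.cycleFactorsFinset := by
  let F : α → {x // σ x = x} ⊕ {c // c ∈ σ.cycleFactorsFinset} := fun x =>
    if h : σ x = x then .inl ⟨x, h⟩ else
      .inr ⟨σ.cycleOf x,
        Equiv.Perm.cycleOf_mem_cycleFactorsFinset_iff.2 (Equiv.Perm.mem_support.2 h)⟩
  have hF : Function.Surjective F := by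
    rintro (⟨x, hx⟩ | ⟨c, hc⟩)
    · exact ⟨x, by simp [F, hx]⟩
    · have hcyc := (Equiv.Perm.mem_cycleFactorsFinset_iff.1 hc).1
      obtain ⟨x, hx⟩ := hcyc.nonempty_support
      have hxσ := Equiv.Perm.mem_cycleFactorsFinset_support_le hc hx
      have e := Equiv.Perm.cycle_is_cycleOf hx hc
      exact ⟨x, by simp [F, Equiv.Perm.mem_support.1 hxσ, e]⟩
  have hker : (⟨σ.SameCycle, Equiv.Perm.SameCycle.equivalence σ⟩ : Setoid α) = Setoid.ker F := by
    ext x y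
    change σ.SameCycle x y ↔ F x = F y
    by_cases hx : σ x = x
    · by_cases hy : σ y = y
      · simp only [F, hx, hy, dite_true, Sum.inl.injEq, Subtype.mk.injEq]
        exact ⟨fun h => h.eq_of_left hx, fun h => h ▸ .rfl⟩
      · simp only [F, hx, hy, dite_true, dite_false, reduceCtorEq, iff_false]
        exact fun h => hy (h.eq_of_left hx ▸ hx)
    · by_cases hy : σ y = y
      · simp only [F, hx, hy, dite_true, dite_false, reduceCtorEq, iff_false]
        exact fun h => hx (h.eq_of_right hy ▸ hy)
      · simp only [F, hx, hy, dite_false, Sum.inr.injEq, Subtype.mk.injEq]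
        exact Equiv.Perm.sameCycle_iff_cycleOf_eq_of_mem_support (Equiv.Perm.mem_support.2 hx)
          (Equiv.Perm.mem_support.2 hy)
  rw [cycleCount, hker, Nat.card_congr (Setoid.quotientKerEquivOfSurjective _ hF), Nat.card_sum]
  congr 1
  · rw [← Finset.card_compl, Nat.card_eq_fintype_card, Fintype.card_subtype]
    congr 1
    ext x
    simp
  · simp

theorem neg_one_pow_cycleCount {α : Type*} [Fintype α] (h : Even (Fintype.card α))
    (σ : Equiv.Perm α) : (-1 : ℤ) ^ cycleCount σ = Equiv.Perm.sign σ := by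
  have hle : #σ.support ≤ Fintype.card α := Finset.card_le_univ _
  rw [Equiv.Perm.sign_of_cycleType, Equiv.Perm.sum_cycleType, Equiv.Perm.cycleType_def, Multiset.card_map,
    Finset.card_val,
    cycleCount_eq_add]
  push_cast
  rw [pow_add, pow_add]
  congr 1
  rcases Nat.even_or_odd #σ.support with hs | hs
  · rw [hs.neg_one_pow, ((Nat.even_sub hle).2 (by tauto)).neg_one_pow]
  · rw [hs.neg_one_pow, Odd.neg_one_pow]
    exact (Nat.odd_sub hle).2 (iff_of_false (Nat.not_odd_iff_even.2 h) (Nat.not_even_iff_odd.2 hs))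

/-- The zero-one matrix whose permutation expansion runs over the D-permutations preserving
a colouring. -/
noncomputable def coloredDMatrix (V : Finset ℕ) {ι : Type*} (f : {x // x ∈ V} → ι) :
    Matrix {x // x ∈ V} {x // x ∈ V} ℤ := Matrix.of fun j i =>
  if ((Odd (i : ℕ) → (i : ℕ) ≤ j) ∧ (Even (i : ℕ) → (j : ℕ) ≤ i)) ∧ f i = f j then 1 else 0

variable {V : Finset ℕ} {ι : Type*} (f : {x // x ∈ V} → ι)

theorem prod_coloredDMatrix (σ : Equiv.Perm {x // x ∈ V}) :
    ∏ i, coloredDMatrix V f (σ i) i =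
      if IsDPerm V σ ∧ ∀ i, f i = f (σ i) then 1 else 0 := by
  simp only [coloredDMatrix, Matrix.of_apply, Finset.prod_ite_zero, Finset.prod_const_one, IsDPerm,
    Finset.mem_univ, true_implies, forall_and]

theorem eq_one_of_isProperColoring (hf : IsProperColoring V f) (σ : Equiv.Perm {x // x ∈ V})
    (hσ : IsDPerm V σ) (hfσ : ∀ i, f i = f (σ i)) : σ = 1 := by
  let b : {x // x ∈ V} → ℤ := fun i => if Odd (i : ℕ) then (i : ℤ) else -(i : ℤ)
  have hb : ∀ i ∈ (Finset.univ : Finset {x // x ∈ V}), b i ≤ b (σ i) := by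
    intro i _
    have hadj : ¬ (ferrers V).Adj i (σ i) := fun h => hf _ _ h (hfσ i)
    rw [ferrers_adj_iff] at hadj
    have h1 := hσ i
    simp only [Finset.coe_mem, true_and, ← Nat.not_odd_iff_even] at hadj h1
    simp only [b]
    by_cases h2 : Odd (i : ℕ) <;> by_cases h3 : Odd (σ i : ℕ) <;> grind
  have hsum : ∑ i, b i = ∑ i, b (σ i) := (Equiv.sum_comp σ b).symm
  ext i
  have he := (Finset.sum_eq_sum_iff_of_le hb).1 hsum i (Finset.mem_univ i)
  have hadj : ¬ (ferrers V).Adj i (σ i) := fun h => hf _ _ h (hfσ i)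
  simp only [b] at he
  rw [Equiv.Perm.one_apply]
  split_ifs at he <;> grind

theorem det_coloredDMatrix_of_isProperColoring (hf : IsProperColoring V f) :
    (coloredDMatrix V f).det = 1 := by
  rw [Matrix.det_apply', Finset.sum_eq_single 1]
  · rw [prod_coloredDMatrix, if_pos]
    · simp
    · simp [IsDPerm]
  · intro σ _ hσ
    rw [prod_coloredDMatrix, if_neg, mul_zero]
    exact fun h => hσ (eq_one_of_isProperColoring f hf σ h.1 h.2)
  · simp

/-- Two vertices of the same colour, an odd one followed by an even one, that are closest
possible, give equal rows. -/
theorem det_coloredDMatrix_of_not_isProperColoring (hf : ¬ IsProperColoring V f) :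
    (coloredDMatrix V f).det = 0 := by
  have hex : ∃ d, ∃ u v : {x // x ∈ V},
      (v : ℕ) - u = d ∧ (u : ℕ) < v ∧ Odd (u : ℕ) ∧ Even (v : ℕ) ∧ f u = f v := by
    simp only [IsProperColoring, not_forall, not_not] at hf
    obtain ⟨u, v, huv, e⟩ := hf
    rcases (ferrers_adj_iff.1 huv).2.2 with h | h
    · exact ⟨_, u, v, rfl, h.1, h.2.1, h.2.2, e⟩
    · exact ⟨_, v, u, rfl, h.1, h.2.1, h.2.2, e.symm⟩
  obtain ⟨d, ⟨u, v, hd, huv, hu, hv, e⟩, hlt⟩ := Nat.findX hex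
  have hmin : ∀ u' v' : {x // x ∈ V}, (u' : ℕ) < v' → Odd (u' : ℕ) → Even (v' : ℕ) →
      f u' = f v' → (v : ℕ) - u ≤ v' - u' := fun u' v' h1 h2 h3 h4 => by
    by_contra! h
    exact hlt _ (hd ▸ h) ⟨u', v', rfl, h1, h2, h3, h4⟩
  have hne : u ≠ v := fun h => huv.ne (congrArg Subtype.val h)
  refine Matrix.det_zero_of_row_eq hne (funext fun w => ?_)
  have h : f w = f u → (w : ℕ) ≤ u ∨ (v : ℕ) ≤ w := by
    intro hw
    by_contra! hlt
    rcases Nat.even_or_odd (w : ℕ) with h | h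
    · have := hmin u w hlt.1 hu h hw.symm
      omega
    · have := hmin w v hlt.2 h hv (hw.trans e)
      omega
  by_cases hw : f w = f u
  · have h1 := h hw
    have h2 : (w : ℕ) = u → ¬ Even (w : ℕ) := fun hwu => by
      rw [hwu]; exact Nat.not_even_iff_odd.2 hu
    have h3 : (w : ℕ) = v → ¬ Odd (w : ℕ) := fun hwu => by
      rw [hwu]; exact Nat.not_odd_iff_even.2 hv
    simp only [coloredDMatrix, Matrix.of_apply, hw, ← e, and_true]
    refine if_congr (and_congr ?_ ?_) rfl rfl
    · refine imp_congr_right fun hodd => ⟨fun _ => by omega, fun _ => ?_⟩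
      have hwv : (w : ℕ) ≠ v := fun hwv => h3 hwv hodd
      omega
    · refine imp_congr_right fun heven => ⟨fun _ => ?_, fun _ => by omega⟩
      have hwu : (w : ℕ) ≠ u := fun hwu => h2 hwu heven
      omega
  · simp [coloredDMatrix, ← e, hw]

theorem forall_sameCycle_imp_eq_iff {α β : Type*} (σ : Equiv.Perm α) (g : α → β) :
    (∀ x y, σ.SameCycle x y → g x = g y) ↔ ∀ x, g x = g (σ x) := by
  refine ⟨fun h x => h _ _ (Equiv.Perm.sameCycle_apply_right.2 .rfl), fun h x y hxy => ?_⟩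
  obtain ⟨k, rfl⟩ := hxy
  induction k using Int.induction_on with
  | zero => simp
  | succ k ih => rw [ih, h, ← Equiv.Perm.mul_apply, ← zpow_one_add, add_comm]
  | pred k ih => rw [ih, h ((σ ^ (-(k : ℤ) - 1)) x), ← Equiv.Perm.mul_apply, ← zpow_one_add]; simp

/-- The signed count of D-permutations by cycles counts proper colourings. -/
theorem sum_sign_mul_pow_eq_card_isProperColoring (V : Finset ℕ) (q : ℕ) :
    ∑ σ ∈ Finset.univ.filter fun σ : Equiv.Perm {x // x ∈ V} => IsDPerm V σ,
        (Equiv.Perm.sign σ : ℤ) * (q : ℤ) ^ cycleCount σ =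
      #{f : {x // x ∈ V} → Fin q | IsProperColoring V f} := by
  calc
    _ = ∑ σ : Equiv.Perm {x // x ∈ V}, ∑ f : {x // x ∈ V} → Fin q,
          (Equiv.Perm.sign σ : ℤ) * ∏ i, coloredDMatrix V f (σ i) i := by
      rw [Finset.sum_filter]
      refine Finset.sum_congr rfl fun σ _ => ?_
      simp only [prod_coloredDMatrix]
      rw [← Finset.mul_sum]
      by_cases hσ : IsDPerm V σ
      · rw [if_pos hσ, cycleCount, ← Nat.cast_pow, ← card_filter_constant_on_classes]
        congr 1
        simp only [hσ, true_and, Finset.sum_boole, Nat.cast_inj]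
        congr 1
        ext f
        simp only [Finset.mem_filter, Finset.mem_univ, true_and]
        exact forall_sameCycle_imp_eq_iff σ f
      · simp [hσ]
    _ = ∑ f : {x // x ∈ V} → Fin q, if IsProperColoring V f then 1 else 0 := by
      rw [Finset.sum_comm]
      refine Finset.sum_congr rfl fun f _ => ?_
      have hdet := Matrix.det_apply' (coloredDMatrix V f)
      simp only [Int.cast_id] at hdet
      rw [← hdet]
      split_ifs with hf
      · exact det_coloredDMatrix_of_isProperColoring f hf
      · exact det_coloredDMatrix_of_not_isProperColoring f hf
    _ = _ := by simp

end Permutation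

open Polynomial in
/-- The characteristic polynomial of the bond lattice of a Ferrers graph on an even number of
vertices is the signed cycle enumerator of D-permutations. -/
theorem charpoly_bond_eq_sum_isDPerm (V : Finset ℕ) (hne : V.Nonempty) (heven : Even #V)
    (μ : Finpartition V → ℤ)
    (hμ : ∀ b, IsBond V b →
      (∑ c ∈ Finset.univ.filter fun c => IsBond V c ∧ c ≤ b, μ c) = if ⊥ = b then 1 else 0) :
    (∑ P ∈ Finset.univ.filter fun P : Finpartition V => IsBond V P,
        Polynomial.C (μ P) * Polynomial.X ^ (P.parts.card - 1)) =
      ∑ σ ∈ Finset.univ.filter fun σ : Equiv.Perm {x // x ∈ V} => IsDPerm V σ,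
        Polynomial.C ((-1 : ℤ) ^ cycleCount σ) * Polynomial.X ^ (cycleCount σ - 1) := by
  refine mul_right_cancel₀ (X_ne_zero (R := ℤ)) ?_
  rw [Finset.sum_mul, Finset.sum_mul]
  refine Polynomial.eq_of_infinite_eval_eq _ _
    ((Set.infinite_range_of_injective (Nat.cast_injective (R := ℤ))).mono ?_)
  rintro _ ⟨q, rfl⟩
  rw [Set.mem_ofPred_eq]
  have hparts : ∀ P : Finpartition V, #P.parts - 1 + 1 = #P.parts := by
    intro P
    obtain ⟨x, hx⟩ := hne
    exact Nat.sub_add_cancel (Finset.card_pos.2 ⟨_, P.part_mem.2 hx⟩)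
  have hcycles : ∀ σ : Equiv.Perm {x // x ∈ V}, cycleCount σ - 1 + 1 = cycleCount σ := by
    intro σ
    have : Nonempty {x // x ∈ V} := hne.to_subtype
    have : Nonempty (Quotient (⟨σ.SameCycle, Equiv.Perm.SameCycle.equivalence σ⟩ :
        Setoid {x // x ∈ V})) :=
      Nonempty.map (Quotient.mk _) ‹_›
    exact Nat.sub_add_cancel Nat.card_pos
  have hcard : Even (Fintype.card {x // x ∈ V}) := by simpa using heven
  simp only [mul_assoc, ← pow_succ, hparts, hcycles, eval_finsetSum, eval_mul, eval_C, eval_pow,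
    eval_X, neg_one_pow_cycleCount hcard]
  refine (sum_moebius_mul_pow_eq_card_isProperColoring V q μ hμ).trans ?_
  convert (sum_sign_mul_pow_eq_card_isProperColoring V q).symm

open Polynomial in
/-- The characteristic polynomial `χ_{2n}(t) = Σ_π μ(0̂,π) t^{b(π)-1}` of the bond lattice of
`Γ_{2n}` equals `Σ_{σ ∈ D_{2n}} (-1)^{c(σ)} t^{c(σ)-1}`.  Here `μ` is any function satisfying
the defining recurrence of the Möbius function of the bond lattice. -/
theorem stmt10 (n : ℕ) (hn : 1 ≤ n)
    (μ : Finpartition (Finset.Icc 1 (2 * n)) → Finpartition (Finset.Icc 1 (2 * n)) → ℤ)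
    (hμ : ∀ a b : Finpartition (Finset.Icc 1 (2 * n)),
      IsBond (Finset.Icc 1 (2 * n)) a → IsBond (Finset.Icc 1 (2 * n)) b → a ≤ b →
      (∑ c ∈ Finset.univ.filter fun c => IsBond (Finset.Icc 1 (2 * n)) c ∧ a ≤ c ∧ c ≤ b,
        μ a c) = if a = b then 1 else 0) :
    (∑ P ∈ Finset.univ.filter
        fun P : Finpartition (Finset.Icc 1 (2 * n)) => IsBond (Finset.Icc 1 (2 * n)) P,
        Polynomial.C (μ ⊥ P) * Polynomial.X ^ (P.parts.card - 1)) =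
      ∑ σ ∈ Finset.univ.filter
        fun σ : Equiv.Perm {x // x ∈ Finset.Icc 1 (2 * n)} => IsDPerm (Finset.Icc 1 (2 * n)) σ,
        Polynomial.C ((-1 : ℤ) ^ cycleCount σ) * Polynomial.X ^ (cycleCount σ - 1) := by
  have h := charpoly_bond_eq_sum_isDPerm (Finset.Icc 1 (2 * n)) ⟨1, by simp; omega⟩ (by simp)
    (μ ⊥) fun b hb => by simpa using hμ ⊥ b isBond_bot hb bot_le
  convert h
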